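/- There exist constants k > 0 and k₁ > 0 such that for every δ ∈ (0, 1/2) and every δ̃ ∈ (0, 1) there exists B₀ with the following property: for all integers B ≥ B₀ and all x ≥ 0, writing m(x, B) = 1 − 𝔼[ exp(√x Z₁) / ( exp(√x Z₁) + exp(−x) Σ_{j=2}^B exp(√x Z_j) ) ] with Z₁, …, Z_B i.i.d. standard Gaussian, one has: (i) if x > (2 + δ) ln B then m(x, B) ≤ B^{−kδ²}/(δ √(ln B)); and (ii) if x < (2 − δ̃) ln B then m(x, B) > 1 − B^{−k₁δ̃²}. -/

import Mathlib

open MeasureTheory ProbabilityTheory Real Filter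

noncomputable section

/-- The law of `B` i.i.d. standard Gaussians. -/
def gaussPi (B : ℕ) : Measure (Fin B → ℝ) := Measure.pi fun _ => gaussianReal 0 1

/-- The normalized MMSE `m(x, B) = mmse(1/τ)/E` for the prior `p₁`, where `x = E/τ`. -/
def mNorm (B : ℕ) [NeZero B] (x : ℝ) : ℝ :=
  1 - ∫ z, exp (sqrt x * z 0) /
      (exp (sqrt x * z 0) +
        exp (-x) * ∑ j ∈ Finset.univ.erase (0 : Fin B), exp (sqrt x * z j))
    ∂ gaussPi B

instance gaussPi_prob (B : ℕ) : IsProbabilityMeasure (gaussPi B) := by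
  unfold gaussPi; infer_instance

lemma exp_lin (B : ℕ) (a : Fin B → ℝ) :
    Integrable (fun z => exp (∑ i, a i * z i)) (gaussPi B) ∧
    ∫ z, exp (∑ i, a i * z i) ∂ gaussPi B = exp (∑ i, (a i) ^ 2 / 2) := by
  have h1 : (fun z : Fin B → ℝ => exp (∑ i, a i * z i)) = fun z => ∏ i, exp (a i * z i) := by
    funext z; rw [exp_sum]
  have h2 : ∀ i, ∫ y, exp (a i * y) ∂ (gaussianReal 0 1) = exp ((a i) ^ 2 / 2) := by
    intro i
    have := congrFun (mgf_id_gaussianReal (μ := 0) (v := 1)) (a i)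
    simpa [mgf] using this
  constructor
  · rw [h1]
    unfold gaussPi
    exact Integrable.fintype_prod (f := fun i y => exp (a i * y))
      (fun i => integrable_exp_mul_gaussianReal (a i))
  · rw [h1]
    unfold gaussPi
    rw [integral_fintype_prod_eq_prod (f := fun i y => exp (a i * y)), exp_sum]
    exact Finset.prod_congr rfl fun i _ => h2 i

lemma exp_one (B : ℕ) [NeZero B] (α : ℝ) :
    Integrable (fun z => exp (α * z 0)) (gaussPi B) ∧
    ∫ z, exp (α * z 0) ∂ gaussPi B = exp (α ^ 2 / 2) := by
  have h := exp_lin B (fun i => if i = 0 then α else 0)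
  have e : ∀ i : Fin B, ((if i = 0 then α else 0) ^ 2 / 2 : ℝ) = if i = 0 then α ^ 2 / 2 else 0 := by
    intro i; split_ifs <;> simp
  simp only [e] at h
  simpa [ite_mul] using h

lemma exp_two (B : ℕ) [NeZero B] (α β : ℝ) (j : Fin B) (hj : j ≠ 0) :
    Integrable (fun z => exp (α * z 0) * exp (β * z j)) (gaussPi B) ∧
    ∫ z, exp (α * z 0) * exp (β * z j) ∂ gaussPi B = exp (α ^ 2 / 2 + β ^ 2 / 2) := by
  have h := exp_lin B (fun i => (if i = 0 then α else 0) + (if i = j then β else 0))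
  have e : ∀ i : Fin B, (((if i = 0 then α else 0) + (if i = j then β else 0)) ^ 2 / 2 : ℝ)
      = (if i = 0 then α ^ 2 / 2 else 0) + (if i = j then β ^ 2 / 2 else 0) := by
    intro i
    by_cases h0 : i = 0
    · simp [h0, hj.symm]
    · simp only [h0, if_false, zero_add]; split_ifs <;> simp
  simp only [e] at h
  simpa [add_mul, ite_mul, Finset.sum_add_distrib, exp_add] using h

lemma ptwise1 (θ r w : ℝ) (h0 : 0 < θ) (h1 : θ < 1) (hr : 0 ≤ r) :
    r / (1 + r) ≤ exp (θ * w) * (1 - θ + θ * (r * exp (-w))) := by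
  have hle : r / (1 + r) ≤ r ^ θ := by
    rcases eq_or_lt_of_le hr with h | h
    · subst h; simp [Real.zero_rpow h0.ne']
    · rcases le_total r 1 with h' | h'
      · calc r / (1 + r) ≤ r := div_le_self hr (by linarith)
          _ = r ^ (1:ℝ) := (Real.rpow_one r).symm
          _ ≤ r ^ θ := Real.rpow_le_rpow_of_exponent_ge h h' h1.le
      · calc r / (1 + r) ≤ 1 := by rw [div_le_one (by linarith)]; linarith
          _ ≤ r ^ θ := Real.one_le_rpow h' h0.le
  have hg := Real.geom_mean_le_arith_mean2_weighted (w₁ := 1 - θ) (w₂ := θ) (p₁ := 1)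
    (p₂ := r * exp (-w)) (by linarith) h0.le zero_le_one (by positivity) (by ring)
  rw [Real.one_rpow, one_mul, mul_one, Real.mul_rpow hr (exp_pos _).le, ← Real.exp_mul] at hg
  calc r / (1 + r) ≤ r ^ θ := hle
    _ = exp (θ * w) * (r ^ θ * exp (-w * θ)) := by
      rw [mul_left_comm, ← exp_add]; ring_nf; simp
    _ ≤ _ := mul_le_mul_of_nonneg_left hg (exp_pos _).le

lemma ratio_integrable (B : ℕ) [NeZero B] (x : ℝ) :
    Integrable (fun z : Fin B → ℝ => exp (sqrt x * z 0) /
      (exp (sqrt x * z 0) +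
        exp (-x) * ∑ j ∈ Finset.univ.erase (0 : Fin B), exp (sqrt x * z j))) (gaussPi B) := by
  refine Integrable.of_bound (C := 1) ?_ ?_
  · apply Measurable.aestronglyMeasurable
    fun_prop
  · refine Eventually.of_forall fun z => ?_
    have hs : 0 ≤ exp (-x) * ∑ j ∈ Finset.univ.erase (0 : Fin B), exp (sqrt x * z j) := by
      positivity
    rw [Real.norm_of_nonneg (by positivity), div_le_one (by positivity)]
    linarith

lemma upper (B : ℕ) [NeZero B] (x θ : ℝ) (hx : 0 ≤ x) (h0 : 0 < θ) (h1 : θ < 1) :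
    mNorm B x ≤ exp (θ * (Real.log B - x / 2) + θ ^ 2 * x / 2) := by
  set L := Real.log B with hL
  have hB : (0:ℝ) < B := by exact_mod_cast Nat.pos_of_ne_zero (NeZero.ne B)
  have hBL : exp L = B := exp_log hB
  set α := -(θ * sqrt x) with hα
  have hpt : ∀ z : Fin B → ℝ, 1 - exp (sqrt x * z 0) /
      (exp (sqrt x * z 0) +
        exp (-x) * ∑ j ∈ Finset.univ.erase (0 : Fin B), exp (sqrt x * z j)) ≤
      exp (θ * (L - x / 2)) * ((1 - θ) * exp (α * z 0) + θ * exp (- x / 2 - L) *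
        ∑ j ∈ Finset.univ.erase (0 : Fin B), exp (α * z 0) * exp (sqrt x * z j)) := by
    intro z
    set S := ∑ j ∈ Finset.univ.erase (0 : Fin B), exp (sqrt x * z j) with hS
    have hS0 : 0 ≤ S := by positivity
    have := ptwise1 θ (exp (-x - sqrt x * z 0) * S) (L - x / 2 - sqrt x * z 0) h0 h1 (by positivity)
    have e1 : 1 - exp (sqrt x * z 0) / (exp (sqrt x * z 0) + exp (-x) * S) =
      (exp (-x - sqrt x * z 0) * S) / (1 + exp (-x - sqrt x * z 0) * S) := by
      rw [sub_eq_add_neg (-x), exp_add, exp_neg (sqrt x * z 0)]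
      have := exp_pos (sqrt x * z 0)
      have := exp_pos (-x)
      field_simp
      ring
    rw [e1]
    refine this.trans (le_of_eq ?_)
    rw [← Finset.mul_sum, ← hS]
    have e2 : exp (θ * (L - x / 2 - sqrt x * z 0)) = exp (θ * (L - x / 2)) * exp (α * z 0) := by
      rw [← exp_add]; congr 1; rw [hα]; ring
    have e3 : exp (-x - sqrt x * z 0) * S * exp (-(L - x / 2 - sqrt x * z 0)) =
        exp (- x / 2 - L) * S := by
      rw [mul_right_comm, ← exp_add]; congr 2; ring
    rw [e2, e3]; ring
  have hi1 := exp_one B α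
  have hi2 := fun j (hj : j ∈ Finset.univ.erase (0 : Fin B)) =>
    exp_two B α (sqrt x) j (Finset.ne_of_mem_erase hj)
  have hint2 : Integrable (fun z : Fin B → ℝ =>
      ∑ j ∈ Finset.univ.erase (0 : Fin B), exp (α * z 0) * exp (sqrt x * z j)) (gaussPi B) :=
    integrable_finsetSum _ fun j hj => (hi2 j hj).1
  have hr := ratio_integrable B x
  have hm : mNorm B x = ∫ z, (1 - exp (sqrt x * z 0) /
      (exp (sqrt x * z 0) +
        exp (-x) * ∑ j ∈ Finset.univ.erase (0 : Fin B), exp (sqrt x * z j))) ∂ gaussPi B := by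
    rw [integral_sub (integrable_const _) hr]; simp [mNorm]
  rw [hm]
  refine (integral_mono ((integrable_const _).sub hr)
    (((hi1.1.const_mul (1 - θ)).add (hint2.const_mul _)).const_mul _) hpt).trans ?_
  rw [integral_const_mul, integral_add' (hi1.1.const_mul (1 - θ)) (hint2.const_mul _),
    integral_const_mul, integral_const_mul, hi1.2, integral_finsetSum _ fun j hj => (hi2 j hj).1,
    Finset.sum_congr rfl fun j hj => (hi2 j hj).2, Finset.sum_const, nsmul_eq_mul, exp_add (θ * (L - x / 2))]
  refine mul_le_mul_of_nonneg_left ?_ (exp_pos _).le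
  have hα2 : α ^ 2 / 2 = θ ^ 2 * x / 2 := by
    rw [hα, neg_sq, mul_pow, Real.sq_sqrt hx]
  rw [hα2, Real.sq_sqrt hx]
  have hc : ((Finset.univ.erase (0 : Fin B)).card : ℝ) ≤ exp L := by
    rw [hBL]
    exact_mod_cast (Finset.card_le_univ _).trans (by simp)
  have e4 : exp (-x / 2 - L) * (exp L * exp (θ ^ 2 * x / 2 + x / 2)) = exp (θ ^ 2 * x / 2) := by
    rw [← exp_add, ← exp_add]; congr 1; ring
  calc _ ≤ (1 - θ) * exp (θ ^ 2 * x / 2) + θ * exp (-x / 2 - L) *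
        (exp L * exp (θ ^ 2 * x / 2 + x / 2)) := by gcongr
    _ = _ := by rw [mul_assoc θ, e4]; ring

lemma p_lower (u : ℝ) (hu : 0 ≤ u) :
    (√(2 * π))⁻¹ * exp (-(u + 1) ^ 2 / 2) ≤ (gaussianReal 0 1).real (Set.Ici u) := by
  have h1 : (gaussianReal 0 1).real (Set.Icc u (u + 1)) ≤ (gaussianReal 0 1).real (Set.Ici u) :=
    measureReal_mono Set.Icc_subset_Ici_self
  refine le_trans ?_ h1
  rw [measureReal_def, gaussianReal_apply_eq_integral 0 one_ne_zero,
    ENNReal.toReal_ofReal (integral_nonneg fun x => gaussianPDFReal_nonneg _ _ _)]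
  have h2 : ∫ _ in Set.Icc u (u + 1), (√(2 * π))⁻¹ * exp (-(u + 1) ^ 2 / 2) =
     (√(2 * π))⁻¹ * exp (-(u + 1) ^ 2 / 2) := by
    simp
  rw [← h2]
  refine setIntegral_mono_on (integrableOn_const (by simp)) (integrable_gaussianPDFReal 0 1).integrableOn
    measurableSet_Icc ?_
  intro y hy
  simp only [gaussianPDFReal, NNReal.coe_one, mul_one, sub_zero]
  gcongr
  · exact hu.trans hy.1
  · exact hy.2

lemma ptwise2 (θ a w : ℝ) (h0 : 0 ≤ θ) (h1 : θ ≤ 1) (ha1 : a ≤ 1) (ha : a ≤ exp w) :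
    a ≤ exp (θ * w) := by
  rcases le_total w 0 with h | h
  · exact ha.trans (exp_le_exp.2 (by nlinarith))
  · exact ha1.trans (one_le_exp (by positivity))

lemma lower (B : ℕ) [NeZero B] (x θ μ q : ℝ) (hx : 0 ≤ x) (h0 : 0 ≤ θ) (h1 : θ ≤ 1)
    (hμ : μ = ((B : ℝ) - 1) * (gaussianReal 0 1).real (Set.Ici (sqrt x)))
    (hq : 2 * exp q ≤ μ) :
    1 - mNorm B x ≤ 2 * exp (-q) + exp (θ ^ 2 * x / 2 - θ * q) := by
  have hμ0 : 0 < μ := lt_of_lt_of_le (by positivity) hq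
  set f : ℝ → ℝ := (Set.Ici (sqrt x)).indicator 1 with hf
  set s := Finset.univ.erase (0 : Fin B) with hs
  have hfm : Measurable f := measurable_one.indicator measurableSet_Ici
  have hf0 : ∀ y, 0 ≤ f y := fun y => Set.indicator_nonneg (fun _ _ => zero_le_one) y
  have hf1 : ∀ y, f y ≤ 1 := fun y => Set.indicator_le_self' (f := (1 : ℝ → ℝ)) (fun _ _ => zero_le_one) y
  set p := (gaussianReal 0 1).real (Set.Ici (sqrt x)) with hp
  have hfint : ∫ y, f y ∂ (gaussianReal 0 1) = p := by
    rw [hf, integral_indicator_one measurableSet_Ici]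
  have hfL : MemLp f 2 (gaussianReal 0 1) :=
    MemLp.of_bound hfm.aestronglyMeasurable 1 (Eventually.of_forall fun y => by
      rw [Real.norm_of_nonneg (hf0 y)]; exact hf1 y)
  set X : Fin B → (Fin B → ℝ) → ℝ := fun i z => f (z i) with hX
  have hmp : ∀ i, MeasurePreserving (Function.eval i) (gaussPi B) (gaussianReal 0 1) := fun i =>
    measurePreserving_eval (fun _ : Fin B => gaussianReal 0 1) i
  have hXL : ∀ i, MemLp (X i) 2 (gaussPi B) := fun i => hfL.comp_measurePreserving (hmp i)
  have hXint : ∀ i, ∫ z, X i z ∂ gaussPi B = p := by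
    intro i
    rw [← hfint, ← (hmp i).map_eq, integral_map (hmp i).measurable.aemeasurable
      hfm.aestronglyMeasurable]
  have hXvar : ∀ i, Var[X i; gaussPi B] ≤ p := by
    intro i
    have h := variance_le_sub_mul_sub (μ := gaussPi B) (a := 0) (b := 1) (X := X i)
      (Eventually.of_forall fun z => ⟨hf0 _, hf1 _⟩) (hXL i).aestronglyMeasurable.aemeasurable
    rw [hXint i] at h
    nlinarith [sq_nonneg p]
  have hcard : (s.card : ℝ) = (B : ℝ) - 1 := by
    rw [hs, Finset.card_erase_of_mem (Finset.mem_univ _), Finset.card_univ, Fintype.card_fin,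
      Nat.cast_sub (Nat.one_le_iff_ne_zero.2 (NeZero.ne B))]
    simp
  have hNL : MemLp (∑ i ∈ s, X i) 2 (gaussPi B) := memLp_finsetSum' _ fun i _ => hXL i
  have hNint : ∫ z, (∑ i ∈ s, X i) z ∂ gaussPi B = μ := by
    simp only [Finset.sum_apply]
    rw [integral_finsetSum _ fun i _ => (hXL i).integrable (by norm_num)]
    simp [hXint, hcard, hμ]
  have hNvar : Var[∑ i ∈ s, X i; gaussPi B] ≤ μ := by
    rw [IndepFun.variance_sum (fun i _ => hXL i)]
    · calc _ ≤ ∑ i ∈ s, p := Finset.sum_le_sum fun i _ => hXvar i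
        _ = μ := by simp [hcard, hμ]
    · intro i _ j _ hij
      exact (iIndepFun_pi (μ := fun _ : Fin B => gaussianReal 0 1) (X := fun _ => f)
        fun i => hfm.aemeasurable).indepFun hij
  rw [variance_eq_integral hNL.aestronglyMeasurable.aemeasurable, hNint] at hNvar
  have hNsq : Integrable (fun z => ((∑ i ∈ s, X i) z - μ) ^ 2) (gaussPi B) :=
    (hNL.sub (memLp_const μ)).integrable_sq
  have hi1 := exp_one B (θ * sqrt x)
  have hr := ratio_integrable B x
  have hpt : ∀ z : Fin B → ℝ, exp (sqrt x * z 0) /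
      (exp (sqrt x * z 0) + exp (-x) * ∑ j ∈ s, exp (sqrt x * z j)) ≤
      4 / μ ^ 2 * ((∑ i ∈ s, X i) z - μ) ^ 2 + exp (-(θ * q)) * exp (θ * sqrt x * z 0) := by
    intro z
    set N := (∑ i ∈ s, X i) z with hN
    set e := exp (sqrt x * z 0) with he
    have he0 : 0 < e := exp_pos _
    have hNs : N ≤ exp (-x) * ∑ j ∈ s, exp (sqrt x * z j) := by
      rw [hN, Finset.sum_apply, Finset.mul_sum]
      refine Finset.sum_le_sum fun j _ => ?_
      by_cases hj : sqrt x ≤ z j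
      · have : X j z = 1 := by simp [hX, hf, Set.indicator, hj]
        rw [this, ← exp_add]
        apply one_le_exp
        nlinarith [Real.mul_self_sqrt hx, Real.sqrt_nonneg x]
      · have : X j z = 0 := by simp [hX, hf, Set.indicator, hj]
        rw [this]; positivity
    set T := exp (-x) * ∑ j ∈ s, exp (sqrt x * z j) with hT
    have hT0 : 0 ≤ T := by positivity
    have hle1 : e / (e + T) ≤ 1 := by rw [div_le_one (by positivity)]; linarith
    rcases lt_or_ge N (μ / 2) with h | h
    · have : 1 ≤ 4 / μ ^ 2 * (N - μ) ^ 2 := by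
        rw [div_mul_eq_mul_div, one_le_div (by positivity)]
        nlinarith
      have := exp_pos (-(θ * q))
      have := exp_pos (θ * sqrt x * z 0)
      nlinarith [mul_pos (exp_pos (-(θ * q))) (exp_pos (θ * sqrt x * z 0))]
    · have h2 : e / (e + T) ≤ exp (sqrt x * z 0 - q) := by
        rw [exp_sub]
        apply div_le_div_of_nonneg_left he0.le (exp_pos _)
        linarith
      have h3 := ptwise2 θ _ _ h0 h1 hle1 h2
      rw [← exp_add]
      have : 0 ≤ 4 / μ ^ 2 * (N - μ) ^ 2 := by positivity
      have h4 : θ * (sqrt x * z 0 - q) = -(θ * q) + θ * sqrt x * z 0 := by ring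
      rw [h4] at h3
      linarith
  have hm : 1 - mNorm B x = ∫ z, (exp (sqrt x * z 0) /
      (exp (sqrt x * z 0) + exp (-x) * ∑ j ∈ s, exp (sqrt x * z j))) ∂ gaussPi B := by
    simp [mNorm, hs]
  rw [hm]
  refine (integral_mono hr ((hNsq.const_mul _).add (hi1.1.const_mul _)) hpt).trans ?_
  rw [integral_add' (hNsq.const_mul _) (hi1.1.const_mul _), integral_const_mul, integral_const_mul,
    hi1.2, ← exp_add]
  apply add_le_add
  · calc _ ≤ 4 / μ ^ 2 * μ := by gcongr
      _ = 4 / μ := by field_simp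
      _ ≤ 4 / (2 * exp q) := by gcongr
      _ = _ := by rw [exp_neg]; field_simp; norm_num
  · apply exp_le_exp.2
    rw [mul_pow, Real.sq_sqrt hx]; linarith

lemma fin1 (B : ℕ) [NeZero B] (δ x : ℝ) (hδ : 0 < δ) (hδ2 : δ < 1 / 2) (hx : 0 ≤ x)
    (hL : 1600 / δ ^ 2 ≤ Real.log B) (h : (2 + δ) * Real.log B < x) :
    mNorm B x ≤ (B : ℝ) ^ (-(1 / 40 * δ ^ 2)) / (δ * Real.sqrt (Real.log B)) := by
  have hB : (0:ℝ) < B := by exact_mod_cast Nat.pos_of_ne_zero (NeZero.ne B)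
  set L := Real.log B with hLdef
  have hL0 : 0 < L := lt_of_lt_of_le (by positivity) hL
  rw [div_le_iff₀ (by positivity)] at hL
  rw [Real.rpow_def_of_pos hB, ← hLdef]
  set θ := δ / (2 * (2 + δ)) with hθ
  have hθe : θ * (2 + δ) = δ / 2 := by rw [hθ]; field_simp
  have hθ0 : 0 < θ := by positivity
  have hθ1 : θ < 1 := by nlinarith
  have hθ2 : δ / 5 ≤ θ := by nlinarith
  refine (upper B x θ hx hθ0 hθ1).trans ?_
  have hexp : θ * (L - x / 2) + θ ^ 2 * x / 2 ≤ -(δ ^ 2 * L / 20) := by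
    have h1 : L - x / 2 + θ * x / 2 ≤ -(δ * L / 4) := by
      have : (1 - θ) * ((2 + δ) * L) ≤ (1 - θ) * x :=
        mul_le_mul_of_nonneg_left h.le (by linarith)
      have e : (1 - θ) * ((2 + δ) * L) = (2 + δ) * L - θ * (2 + δ) * L := by ring
      rw [e, hθe] at this
      linarith
    have h2 : θ * (L - x / 2 + θ * x / 2) ≤ θ * (-(δ * L / 4)) :=
      mul_le_mul_of_nonneg_left h1 hθ0.le
    have h3 : δ / 5 * (δ * L) ≤ θ * (δ * L) := mul_le_mul_of_nonneg_right hθ2 (by positivity)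
    nlinarith
  rw [le_div_iff₀ (by positivity)]
  set w := δ * sqrt L with hw
  have hw2 : w ^ 2 = δ ^ 2 * L := by rw [hw, mul_pow, Real.sq_sqrt hL0.le]
  have hw0 : 0 < w := by positivity
  have hw40 : 40 ≤ w := by nlinarith
  have hwe : w ≤ exp (δ ^ 2 * L / 40) := by
    have := Real.add_one_le_exp (δ ^ 2 * L / 40)
    nlinarith
  calc _ ≤ exp (-(δ ^ 2 * L / 20)) * exp (δ ^ 2 * L / 40) := by gcongr
    _ = _ := by rw [← exp_add]; congr 1; ring

lemma fin2 (B : ℕ) [NeZero B] (δ x : ℝ) (hδ : 0 < δ) (hδ2 : δ < 1) (hx : 0 ≤ x)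
    (hL : 400 / δ ^ 2 ≤ Real.log B) (h : x < (2 - δ) * Real.log B) :
    1 - (B : ℝ) ^ (-(1 / 128 * δ ^ 2)) < mNorm B x := by
  have hB : (0:ℝ) < B := by exact_mod_cast Nat.pos_of_ne_zero (NeZero.ne B)
  set L := Real.log B with hLdef
  have hL0 : 0 < L := lt_of_lt_of_le (by positivity) hL
  have hBL : exp L = B := exp_log hB
  rw [div_le_iff₀ (by positivity)] at hL
  rw [Real.rpow_def_of_pos hB, ← hLdef]
  have hL2 : 400 ≤ L := by nlinarith
  have hB2 : 2 ≤ (B : ℝ) := by rw [← hBL]; linarith [Real.add_one_le_exp L]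
  set y := sqrt x with hy
  have hy0 : 0 ≤ y := Real.sqrt_nonneg x
  have hyx : y ^ 2 = x := Real.sq_sqrt hx
  have hp := p_lower y hy0
  set p := (gaussianReal 0 1).real (Set.Ici y) with hpdef
  have hq : 2 * exp (δ * L / 4) ≤ ((B : ℝ) - 1) * p := by
    have e1 : (4:ℝ) ≤ exp 2 := by
      have h1 := Real.add_one_le_exp (1:ℝ)
      have : exp 2 = exp 1 * exp 1 := by rw [← exp_add]; norm_num
      nlinarith
    have e2 : exp (-2) ≤ (√(2 * π))⁻¹ := by
      rw [exp_neg]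
      apply inv_anti₀ (by positivity)
      rw [Real.sqrt_le_left (by positivity)]
      nlinarith [Real.pi_lt_four]
    have hyb : 9 / 2 + y ≤ δ * L / 4 := by
      have : δ * y ≤ δ ^ 2 * x / 16 + 4 := by nlinarith [sq_nonneg (δ * y / 4 - 2)]
      have h3 : δ ^ 2 * x ≤ δ ^ 2 * (2 * L) :=
        mul_le_mul_of_nonneg_left (by nlinarith) (by positivity)
      have : δ * (9 / 2 + y) ≤ δ * (δ * L / 4) := by nlinarith
      exact le_of_mul_le_mul_left this hδ
    have e3 : 4 * exp (δ * L / 4) ≤ exp L * (exp (-2) * exp (-(y + 1) ^ 2 / 2)) := by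
      calc 4 * exp (δ * L / 4) ≤ exp 2 * exp (δ * L / 4) := by gcongr
        _ = exp (2 + δ * L / 4) := by rw [exp_add]
        _ ≤ exp (L + (-2 + -(y + 1) ^ 2 / 2)) := exp_le_exp.2 (by nlinarith)
        _ = _ := by rw [exp_add, exp_add]
    have e4 : exp (-2) * exp (-(y + 1) ^ 2 / 2) ≤ p := le_trans (by gcongr) hp
    have e5 : exp L * (exp (-2) * exp (-(y + 1) ^ 2 / 2)) ≤ B * p := by
      rw [hBL]; gcongr
    have hp0 : 0 ≤ p := measureReal_nonneg
    nlinarith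
  have := lower B x (δ / 8) _ (δ * L / 4) hx (by positivity) (by linarith) rfl hq
  have hδL : 0 < δ * L := by positivity
  have a1 : exp (-(δ * L / 4)) ≤ exp (-(δ ^ 2 * L / 64)) := exp_le_exp.2 (by nlinarith)
  have a2 : exp ((δ / 8) ^ 2 * x / 2 - δ / 8 * (δ * L / 4)) ≤ exp (-(δ ^ 2 * L / 64)) := by
    apply exp_le_exp.2
    have h3 : δ ^ 2 * x ≤ δ ^ 2 * (2 * L) :=
      mul_le_mul_of_nonneg_left (by nlinarith) (by positivity)
    nlinarith
  have a3 : 3 < exp (δ ^ 2 * L / 128) := by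
    have := Real.add_one_le_exp (δ ^ 2 * L / 128)
    linarith
  have a4 : exp (L * -(1 / 128 * δ ^ 2)) = exp (δ ^ 2 * L / 128) * exp (-(δ ^ 2 * L / 64)) := by
    rw [← exp_add]; congr 1; ring
  have a5 : 3 * exp (-(δ ^ 2 * L / 64)) < exp (L * -(1 / 128 * δ ^ 2)) := by
    rw [a4]; exact mul_lt_mul_of_pos_right a3 (exp_pos _)
  linarith

/-- phase transition of the normalized MMSE at `x ≈ 2 ln B`: there
are constants `k, k₁ > 0` such that for every `δ ∈ (0,1/2)`, `δ̃ ∈ (0,1)` and all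
sufficiently large `B`: if `x > (2+δ) ln B` then `m(x,B) ≤ B^{−kδ²}/(δ√(ln B))`, and if
`x < (2−δ̃) ln B` then `m(x,B) > 1 − B^{−k₁δ̃²}`. -/
theorem stmt19 :
    ∃ k : ℝ, 0 < k ∧ ∃ k₁ : ℝ, 0 < k₁ ∧
      ∀ δ : ℝ, 0 < δ → δ < 1 / 2 → ∀ δt : ℝ, 0 < δt → δt < 1 →
        ∃ B₀ : ℕ, ∀ (B : ℕ) [NeZero B], B₀ ≤ B → ∀ x : ℝ, 0 ≤ x →
          ((2 + δ) * Real.log B < x →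
            mNorm B x ≤ (B : ℝ) ^ (-(k * δ ^ 2)) / (δ * Real.sqrt (Real.log B))) ∧
          (x < (2 - δt) * Real.log B →
            1 - (B : ℝ) ^ (-(k₁ * δt ^ 2)) < mNorm B x) := by
  refine ⟨1 / 40, by norm_num, 1 / 128, by norm_num, ?_⟩
  intro δ hδ hδ2 δt hδt hδt2
  refine ⟨⌈exp (1600 / δ ^ 2 + 400 / δt ^ 2)⌉₊, ?_⟩
  intro B _ hB x hx
  have hB' : exp (1600 / δ ^ 2 + 400 / δt ^ 2) ≤ B := Nat.ceil_le.1 hB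
  have hlog := (Real.le_log_iff_exp_le (lt_of_lt_of_le (exp_pos _) hB')).2 hB'
  have p1 : 0 < 1600 / δ ^ 2 := by positivity
  have p2 : 0 < 400 / δt ^ 2 := by positivity
  exact ⟨fun h => fin1 B δ x hδ hδ2 hx (by linarith) h,
    fun h => fin2 B δt x hδt hδt2 hx (by linarith) h⟩

end
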